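/- arXiv:1112.2313 — 8 statements merged into one kernel-verified Lean document; each statement's English description precedes it below -/
import Mathlib

section
/- Let f : α → β → γ → Bool be a Boolean function, where α, β, γ represent the assignments to the blocks X_A, X_B, X_C of a variable partition X = {X_A|X_B|X_C}. Then there exist functions f_A : α → γ → Bool and f_B : β → γ → Bool such that f a b c = f_A a c || f_B b c for all a, b, c, if and only if there do not exist a, a' : α, b, b' : β, c : γ with f a b c = true, f a' b c = false, and f a b' c = false. -/
/-- Proposition 1: SAT characterization of OR bi-decomposition. -/
theorem or_bidecomposition_iff {α β γ : Type*} (f : α → β → γ → Bool) :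
    (∃ (fA : α → γ → Bool) (fB : β → γ → Bool),
        ∀ a b c, f a b c = (fA a c || fB b c)) ↔
      ¬ ∃ (a a' : α) (b b' : β) (c : γ),
          f a b c = true ∧ f a' b c = false ∧ f a b' c = false := by
  classical
  constructor
  · rintro ⟨fA, fB, h⟩ ⟨a, a', b, b', c, h₁, h₂, h₃⟩
    simp only [h, Bool.or_eq_true, Bool.or_eq_false_iff] at h₁ h₂ h₃
    simp_all
  · intro h
    refine ⟨fun a c => decide (∀ b, f a b c = true),
      fun b c => decide (∀ a, f a b c = true), fun a b c => ?_⟩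
    rw [Bool.eq_iff_iff, Bool.or_eq_true, decide_eq_true_iff, decide_eq_true_iff]
    refine ⟨fun hf => ?_, fun hf => hf.elim (fun hA => hA b) (fun hB => hB a)⟩
    by_contra! hne
    obtain ⟨⟨b', hb'⟩, ⟨a', ha'⟩⟩ := hne
    exact h ⟨a, a', b, b', c, hf, Bool.eq_false_iff.mpr ha', Bool.eq_false_iff.mpr hb'⟩
end

section
/- Let ι be a type, f : (ι → Bool) → Bool, and let A, B, C ⊆ ι be pairwise disjoint sets with A ∪ B ∪ C = Set.univ. Then there exist f_A, f_B : (ι → Bool) → Bool, with f_A depending only on A ∪ C and f_B depending only on B ∪ C, such that f σ = f_A σ || f_B σ for all σ, if and only if there do not exist assignments σ, σ', σ'' : ι → Bool such that σ' agrees with σ on every index outside A, σ'' agrees with σ on every index outside B, and f σ = true, f σ' = false, f σ'' = false. -/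
/-- A Boolean function `g` on assignments depends only on the index set `S`. -/
def DependsOnlyOn {ι : Type*} (g : (ι → Bool) → Bool) (S : Set ι) : Prop :=
  ∀ σ τ : ι → Bool, (∀ i ∈ S, σ i = τ i) → g σ = g τ

/-- Quantifying universally over the variables outside `S` gives a function of `S` alone. -/
theorem dependsOnlyOn_forall_agree {ι : Type*} (f : (ι → Bool) → Bool) (S : Set ι)
    [DecidablePred fun σ : ι → Bool => ∀ τ : ι → Bool, (∀ i ∈ S, τ i = σ i) → f τ = true] :
    DependsOnlyOn
      (fun σ => decide (∀ τ : ι → Bool, (∀ i ∈ S, τ i = σ i) → f τ = true)) S := by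
  intro σ σ' h
  refine decide_eq_decide.mpr (forall_congr' fun τ => imp_congr_left ?_)
  exact forall₂_congr fun i hi => by rw [h i hi]

/-- Correctness of the satisfiability formulation (2) for OR bi-decomposition
under a variable partition `(A, B, C)`. -/
theorem or_bidecomposition_partition_iff {ι : Type*} (f : (ι → Bool) → Bool)
    (A B C : Set ι) (hAB : Disjoint A B) (hAC : Disjoint A C) (hBC : Disjoint B C)
    (hcover : A ∪ B ∪ C = Set.univ) :
    (∃ fA fB : (ι → Bool) → Bool,
        DependsOnlyOn fA (A ∪ C) ∧ DependsOnlyOn fB (B ∪ C) ∧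
          ∀ σ, f σ = (fA σ || fB σ)) ↔
      ¬ ∃ σ σ' σ'' : ι → Bool,
          (∀ i, i ∉ A → σ' i = σ i) ∧ (∀ i, i ∉ B → σ'' i = σ i) ∧
            f σ = true ∧ f σ' = false ∧ f σ'' = false := by
  classical
  have hA : Aᶜ = B ∪ C := IsCompl.compl_eq
    ⟨Set.disjoint_union_right.mpr ⟨hAB, hAC⟩,
      codisjoint_iff.mpr (by simpa [Set.union_assoc] using hcover)⟩
  have hB : Bᶜ = A ∪ C := IsCompl.compl_eq
    ⟨Set.disjoint_union_right.mpr ⟨hAB.symm, hBC⟩,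
      codisjoint_iff.mpr (by simpa [Set.union_left_comm, Set.union_assoc] using hcover)⟩
  constructor
  · rintro ⟨fA, fB, hfA, hfB, hf⟩ ⟨σ, σ', σ'', h', h'', hσ, hσ', hσ''⟩
    have hfBσ := hfB σ' σ fun i hi => h' i (hA.ge hi)
    have hfAσ := hfA σ'' σ fun i hi => h'' i (hB.ge hi)
    rw [hf, Bool.or_eq_false_iff] at hσ' hσ''
    rw [hf, ← hfAσ, ← hfBσ, hσ''.1, hσ'.2] at hσ
    exact Bool.false_ne_true hσ
  · intro h
    refine ⟨_, _, dependsOnlyOn_forall_agree f (A ∪ C),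
      dependsOnlyOn_forall_agree f (B ∪ C), fun σ => ?_⟩
    rw [Bool.eq_iff_iff, Bool.or_eq_true, decide_eq_true_iff, decide_eq_true_iff]
    constructor
    · intro hσ
      by_contra! hne
      obtain ⟨⟨σ'', h'', hσ''⟩, σ', h', hσ'⟩ := hne
      exact h ⟨σ, σ', σ'', fun i hi => h' i (hA.le hi), fun i hi => h'' i (hB.le hi),
        hσ, Bool.eq_false_of_not_eq_true hσ', Bool.eq_false_of_not_eq_true hσ''⟩
    · rintro (hσ | hσ) <;> exact hσ σ fun _ _ => rfl
end

section
/- Let f : α → β → γ → Bool. Define f_A : α → γ → Bool by f_A a c = decide (∀ b, f a b c = true) and f_B : β → γ → Bool by f_B b c = decide (∀ a, f a b c = true) (assuming the relevant propositions are decidable, e.g. α, β finite or using classical choice). Then f a b c = f_A a c || f_B b c holds for all a, b, c if and only if there do not exist a, a', b, b', c with f a b c = true, f a' b c = false, and f a b' c = false. In particular, whenever f admits any OR bi-decomposition, this canonical pair (f_A, f_B) is one. -/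
/-- A function with an OR bi-decomposition admits no `true` entry whose row and column (for a
fixed common assignment) both contain a `false` entry. -/
theorem not_exists_conflict_of_or_decomposition {α β γ : Type*} {f : α → β → γ → Bool}
    {fA : α → γ → Bool} {fB : β → γ → Bool} (h : ∀ a b c, f a b c = (fA a c || fB b c)) :
    ¬ ∃ (a a' : α) (b b' : β) (c : γ),
        f a b c = true ∧ f a' b c = false ∧ f a b' c = false := by
  rintro ⟨a, a', b, b', c, htrue, hcol, hrow⟩
  simp only [h, Bool.or_eq_true, Bool.or_eq_false_iff] at htrue hcol hrow
  simp [hrow.1, hcol.2] at htrue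

open Classical in
/-- In the absence of conflicts, the canonical witnesses form an OR bi-decomposition. -/
theorem eq_canonical_or_of_not_exists_conflict {α β γ : Type*} {f : α → β → γ → Bool}
    (h : ¬ ∃ (a a' : α) (b b' : β) (c : γ),
        f a b c = true ∧ f a' b c = false ∧ f a b' c = false) (a : α) (b : β) (c : γ) :
    f a b c = (decide (∀ b', f a b' c = true) || decide (∀ a', f a' b c = true)) := by
  rw [Bool.eq_iff_iff, Bool.or_eq_true, decide_eq_true_iff, decide_eq_true_iff]
  refine ⟨fun htrue => ?_, fun hall => hall.elim (· b) (· a)⟩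
  by_contra! hne
  obtain ⟨⟨b', hrow⟩, a', hcol⟩ := hne
  exact h ⟨a, a', b, b', c, htrue, Bool.eq_false_of_not_eq_true hcol,
    Bool.eq_false_of_not_eq_true hrow⟩

open Classical in
/-- The canonical witnesses `fA a c = decide (∀ b, f a b c = true)` and
`fB b c = decide (∀ a, f a b c = true)` realize an OR bi-decomposition exactly when
one exists; in particular, any OR bi-decomposable `f` is decomposed by this pair. -/
theorem or_bidecomposition_canonical_witness {α β γ : Type*} (f : α → β → γ → Bool) :
    ((∀ a b c, f a b c =
        (decide (∀ b', f a b' c = true) || decide (∀ a', f a' b c = true))) ↔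
      ¬ ∃ (a a' : α) (b b' : β) (c : γ),
          f a b c = true ∧ f a' b c = false ∧ f a b' c = false) ∧
    ((∃ (fA : α → γ → Bool) (fB : β → γ → Bool),
        ∀ a b c, f a b c = (fA a c || fB b c)) →
      ∀ a b c, f a b c =
        (decide (∀ b', f a b' c = true) || decide (∀ a', f a' b c = true))) := by
  refine ⟨⟨fun h => ?_, eq_canonical_or_of_not_exists_conflict⟩, ?_⟩
  · exact not_exists_conflict_of_or_decomposition
      (fA := fun a c => decide (∀ b', f a b' c = true))
      (fB := fun b c => decide (∀ a', f a' b c = true)) h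
  · rintro ⟨fA, fB, h⟩
    exact eq_canonical_or_of_not_exists_conflict (not_exists_conflict_of_or_decomposition h)
end

section
/- Let f : α → β → γ → Bool be a Boolean function, where α, β, γ represent the assignments to the blocks X_A, X_B, X_C of a variable partition X = {X_A|X_B|X_C}. Then there exist functions f_A : α → γ → Bool and f_B : β → γ → Bool such that f a b c = f_A a c && f_B b c for all a, b, c, if and only if there do not exist a, a' : α, b, b' : β, c : γ with f a b c = false, f a' b c = true, and f a b' c = true. -/
/-- AND analogue of Proposition 1: SAT characterization of AND bi-decomposition. -/
theorem and_bidecomposition_iff {α β γ : Type*} (f : α → β → γ → Bool) :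
    (∃ (fA : α → γ → Bool) (fB : β → γ → Bool),
        ∀ a b c, f a b c = (fA a c && fB b c)) ↔
      ¬ ∃ (a a' : α) (b b' : β) (c : γ),
          f a b c = false ∧ f a' b c = true ∧ f a b' c = true := by
  classical
  constructor
  · rintro ⟨fA, fB, h⟩ ⟨a, a', b, b', c, h₀, h₁, h₂⟩
    simp only [h, Bool.and_eq_true] at h₀ h₁ h₂
    simp [h₁.2, h₂.1] at h₀
  · intro h
    refine ⟨fun a c => decide (∃ b, f a b c = true), fun b c => decide (∃ a, f a b c = true),
      fun a b c => ?_⟩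
    rw [Bool.eq_iff_iff, Bool.and_eq_true, decide_eq_true_iff, decide_eq_true_iff]
    refine ⟨fun hf => ⟨⟨b, hf⟩, ⟨a, hf⟩⟩, ?_⟩
    rintro ⟨⟨b', hb'⟩, ⟨a', ha'⟩⟩
    by_contra hf
    exact h ⟨a, a', b, b', c, Bool.eq_false_of_not_eq_true hf, ha', hb'⟩
end

section
/- Let f : α → β → γ → Bool. Define f_A : α → γ → Bool by f_A a c = decide (∃ b, f a b c = true) and f_B : β → γ → Bool by f_B b c = decide (∃ a, f a b c = true) (assuming decidability, e.g. α, β finite or using classical choice). Then f a b c = f_A a c && f_B b c holds for all a, b, c if and only if there do not exist a, a', b, b', c with f a b c = false, f a' b c = true, and f a b' c = true. In particular, whenever f admits any AND bi-decomposition, this canonical pair (f_A, f_B) is one. -/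
open Classical in
/-- The canonical witnesses `fA a c = decide (∃ b, f a b c = true)` and
`fB b c = decide (∃ a, f a b c = true)` realize an AND bi-decomposition exactly when
one exists; in particular, any AND bi-decomposable `f` is decomposed by this pair. -/
theorem and_bidecomposition_canonical_witness {α β γ : Type*} (f : α → β → γ → Bool) :
    ((∀ a b c, f a b c =
        (decide (∃ b', f a b' c = true) && decide (∃ a', f a' b c = true))) ↔
      ¬ ∃ (a a' : α) (b b' : β) (c : γ),
          f a b c = false ∧ f a' b c = true ∧ f a b' c = true) ∧
    ((∃ (fA : α → γ → Bool) (fB : β → γ → Bool),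
        ∀ a b c, f a b c = (fA a c && fB b c)) →
      ∀ a b c, f a b c =
        (decide (∃ b', f a b' c = true) && decide (∃ a', f a' b c = true))) := by
  have canonical_of_no_conflict (h : ¬ ∃ (a a' : α) (b b' : β) (c : γ),
      f a b c = false ∧ f a' b c = true ∧ f a b' c = true) (a : α) (b : β) (c : γ) :
      f a b c = (decide (∃ b', f a b' c = true) && decide (∃ a', f a' b c = true)) := by
    rw [Bool.eq_iff_iff, Bool.and_eq_true, decide_eq_true_iff, decide_eq_true_iff]
    refine ⟨fun hf => ⟨⟨b, hf⟩, ⟨a, hf⟩⟩, ?_⟩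
    rintro ⟨⟨b', hb'⟩, ⟨a', ha'⟩⟩
    by_contra hf
    exact h ⟨a, a', b, b', c, Bool.eq_false_iff.mpr hf, ha', hb'⟩
  refine ⟨⟨?_, canonical_of_no_conflict⟩, ?_⟩
  · rintro h ⟨a, a', b, b', c, h₀, ha', hb'⟩
    rw [h a b c, decide_eq_true ⟨b', hb'⟩, decide_eq_true ⟨a', ha'⟩] at h₀
    exact absurd h₀ (by decide)
  · rintro ⟨fA, fB, h⟩
    refine canonical_of_no_conflict ?_
    rintro ⟨a, a', b, b', c, h₀, ha', hb'⟩
    simp_all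
end

section
/- Let f : α → β → γ → Bool, with α and β nonempty. There exist f_A : α → γ → Bool and f_B : β → γ → Bool such that f a b c = xor (f_A a c) (f_B b c) for all a, b, c, if and only if for all a, a' : α, b, b' : β, c : γ, xor (f a b c) (xor (f a' b c) (xor (f a b' c) (f a' b' c))) = false. -/
/-- XOR analogue of Proposition 1: `f` is XOR bi-decomposable under the partition
iff the four-term parity condition holds for every pair of cofactor pairs. -/
theorem xor_bidecomposition_iff {α β γ : Type*} [Nonempty α] [Nonempty β]
    (f : α → β → γ → Bool) :
    (∃ (fA : α → γ → Bool) (fB : β → γ → Bool),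
        ∀ a b c, f a b c = xor (fA a c) (fB b c)) ↔
      ∀ (a a' : α) (b b' : β) (c : γ),
        xor (f a b c) (xor (f a' b c) (xor (f a b' c) (f a' b' c))) = false := by
  constructor
  · rintro ⟨fA, fB, h⟩ a a' b b' c
    simp only [h]
    cases fA a c <;> cases fA a' c <;> cases fB b c <;> cases fB b' c <;> rfl
  · intro h
    obtain ⟨a₀⟩ := ‹Nonempty α›
    obtain ⟨b₀⟩ := ‹Nonempty β›
    refine ⟨fun a c => f a b₀ c, fun b c => xor (f a₀ b c) (f a₀ b₀ c), fun a b c => ?_⟩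
    have hc := h a a₀ b b₀ c
    revert hc
    beta_reduce
    cases f a b c <;> cases f a₀ b c <;> cases f a b₀ c <;> cases f a₀ b₀ c <;> decide
end

section
/- Let f : α → β → γ → Bool, with α and β nonempty. The following are equivalent: (i) f admits an XOR bi-decomposition, i.e. there exist f_A : α → γ → Bool, f_B : β → γ → Bool with f a b c = xor (f_A a c) (f_B b c) for all a, b, c; (ii) for every c : γ and every a, a' : α, the function b ↦ xor (f a b c) (f a' b c) is constant in b. -/
/-- `f` admits an XOR bi-decomposition iff for every `c` and every pair `a, a'`,
the Boolean difference `b ↦ xor (f a b c) (f a' b c)` is constant in `b`. -/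
theorem xor_bidecomposition_iff_constant_difference {α β γ : Type*}
    [Nonempty α] [Nonempty β] (f : α → β → γ → Bool) :
    (∃ (fA : α → γ → Bool) (fB : β → γ → Bool),
        ∀ a b c, f a b c = xor (fA a c) (fB b c)) ↔
      ∀ (c : γ) (a a' : α) (b b' : β),
        xor (f a b c) (f a' b c) = xor (f a b' c) (f a' b' c) := by
  constructor
  · rintro ⟨fA, fB, h⟩ c a a' b b'
    simp only [h]
    cases fA a c <;> cases fA a' c <;> cases fB b c <;> cases fB b' c <;> rfl
  · intro h
    obtain ⟨a₀⟩ := ‹Nonempty α›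
    obtain ⟨b₀⟩ := ‹Nonempty β›
    refine ⟨fun a c => xor (f a b₀ c) (f a₀ b₀ c), fun b c => f a₀ b c, fun a b c => ?_⟩
    simp only [← h c a a₀ b b₀, Bool.xor_assoc, Bool.xor_self, Bool.xor_false]
end

section
/- Let ι be a finite type with |ι| = n, and f : (ι → Bool) → Bool. Suppose there exists a non-trivial partition (A,B,C) of ι (A ≠ ∅, B ≠ ∅) with |C| = k under which f admits an OR bi-decomposition. Then for every k' with k ≤ k' ≤ n − 2, there exists a non-trivial partition (A',B',C') of ι with |C'| = k' under which f admits an OR bi-decomposition. In particular, the set of feasible disjointness bounds {k' : some non-trivial partition with |C| ≤ k' admits an OR bi-decomposition of f} is upward closed in {0,…,n−2}. -/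
/-- `f` admits an OR bi-decomposition under the partition `(A, B, C)`. -/
def OrBiDec {ι : Type*} (f : (ι → Bool) → Bool) (A B C : Set ι) : Prop :=
  ∃ fA fB : (ι → Bool) → Bool,
    DependsOnlyOn fA (A ∪ C) ∧ DependsOnlyOn fB (B ∪ C) ∧
      ∀ σ, f σ = (fA σ || fB σ)

theorem DependsOnlyOn.mono {ι : Type*} {g : (ι → Bool) → Bool} {S T : Set ι}
    (hg : DependsOnlyOn g S) (hST : S ⊆ T) : DependsOnlyOn g T :=
  fun σ τ h => hg σ τ fun i hi => h i (hST hi)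

theorem OrBiDec.mono {ι : Type*} {f : (ι → Bool) → Bool} {A B C A' B' C' : Set ι}
    (h : OrBiDec f A B C) (hA : A ∪ C ⊆ A' ∪ C') (hB : B ∪ C ⊆ B' ∪ C') :
    OrBiDec f A' B' C' := by
  obtain ⟨fA, fB, hfA, hfB, hf⟩ := h
  exact ⟨fA, fB, hfA.mono hA, hfB.mono hB, hf⟩

/-- Upward closure of the feasible disjointness bounds: if `f` is OR
bi-decomposable under a non-trivial partition with `|C| = k`, then for every
`k ≤ k' ≤ n - 2` it is OR bi-decomposable under some non-trivial partition
with `|C'| = k'`. -/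
theorem or_bidecomposition_upward_closed {ι : Type*} [Fintype ι] [DecidableEq ι]
    {n : ℕ} (hn : Fintype.card ι = n) (f : (ι → Bool) → Bool)
    (A B C : Finset ι) (k : ℕ)
    (hAB : Disjoint A B) (hAC : Disjoint A C) (hBC : Disjoint B C)
    (hcover : A ∪ B ∪ C = Finset.univ)
    (hA : A.Nonempty) (hB : B.Nonempty) (hC : C.card = k)
    (hdec : OrBiDec f ↑A ↑B ↑C) :
    ∀ k', k ≤ k' → k' ≤ n - 2 →
      ∃ A' B' C' : Finset ι,
        Disjoint A' B' ∧ Disjoint A' C' ∧ Disjoint B' C' ∧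
        A' ∪ B' ∪ C' = Finset.univ ∧
        A'.Nonempty ∧ B'.Nonempty ∧ C'.card = k' ∧
        OrBiDec f ↑A' ↑B' ↑C' := by
  intro k' hk hk'
  obtain ⟨a, ha⟩ := hA
  obtain ⟨b, hb⟩ := hB
  have hab : a ≠ b := fun h => Finset.disjoint_left.1 hAB ha (h ▸ hb)
  have hsub : C ⊆ ({a, b} : Finset ι)ᶜ := by
    intro c hc
    have hca : c ≠ a := fun h => Finset.disjoint_left.1 hAC ha (h ▸ hc)
    have hcb : c ≠ b := fun h => Finset.disjoint_left.1 hBC hb (h ▸ hc)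
    simp [hca, hcb]
  obtain ⟨C', hCC', hC', hcard⟩ := Finset.exists_subsuperset_card_eq hsub (hC.trans_le hk)
    (by rwa [Finset.card_compl, Finset.card_pair hab, hn])
  have haC' : a ∉ C' := fun h => by simpa using hC' h
  have hbC' : b ∉ C' := fun h => by simpa using hC' h
  have hunion (S : Finset ι) :
      (S ∪ C : Set ι) ⊆ ((S \ C' : Finset ι) ∪ C' : Set ι) := by
    rw [Finset.coe_sdiff, Set.sdiff_union_self]
    exact Set.union_subset_union_right _ (Finset.coe_subset.2 hCC')
  refine ⟨A \ C', B \ C', C', hAB.mono Finset.sdiff_subset Finset.sdiff_subset,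
    Finset.sdiff_disjoint, Finset.sdiff_disjoint, ?_,
    ⟨a, Finset.mem_sdiff.2 ⟨ha, haC'⟩⟩, ⟨b, Finset.mem_sdiff.2 ⟨hb, hbC'⟩⟩, hcard,
    hdec.mono (hunion A) (hunion B)⟩
  rw [← Finset.union_sdiff_distrib, Finset.sdiff_union_self_eq_union, Finset.eq_univ_iff_forall]
  intro i
  have hi : i ∈ A ∪ B ∪ C := hcover ▸ Finset.mem_univ i
  exact Finset.union_subset_union_right hCC' hi
end
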